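/- arXiv:2510.25719 — 2 statements merged into one kernel-verified Lean document; each statement's English description precedes it below -/
import Mathlib

section
/- Lemma E.1: Let q : Fin n → ℝ and let Q = blockdiag(q_j·I₂). Let B be a (2n×2n) real symmetric positive-definite matrix commuting with Ω_n * Q, and set A := B * Ω_n * B. Then there exists a (2n×2n) real orthogonal matrix O commuting with Ω_n * Q and strictly positive reals a_1,…,a_n such that O * A * Oᵀ = blockdiag(a_j·Ω₁). -/
open Matrix

noncomputable section

/-- The 2×2 standard symplectic form `Ω₁ = !![0,1; -1,0]`. -/
def Omega1 : Matrix (Fin 2) (Fin 2) ℝ := !![0, 1; -1, 0]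

/-- The 2n×2n standard symplectic form `Ω_n`, a block-diagonal matrix with `n` copies of `Ω₁`. -/
def OmegaN (n : ℕ) : Matrix (Fin 2 × Fin n) (Fin 2 × Fin n) ℝ :=
  Matrix.blockDiagonal fun _ => Omega1

/-- The block-diagonal charge matrix `Q = blockdiag(q_j · I₂)`. -/
def QMat {n : ℕ} (q : Fin n → ℝ) : Matrix (Fin 2 × Fin n) (Fin 2 × Fin n) ℝ :=
  Matrix.blockDiagonal fun j => (q j) • (1 : Matrix (Fin 2) (Fin 2) ℝ)

theorem diag_ex {𝕜 : Type*} [RCLike 𝕜] {m : Type*} [Fintype m] [DecidableEq m] (P : Matrix m m 𝕜)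
    (hP : P.IsHermitian) :
    (hP.eigenvectorUnitary : Matrix m m 𝕜)ᴴ * P * (hP.eigenvectorUnitary : Matrix m m 𝕜)
      = diagonal (fun i => (hP.eigenvalues i : 𝕜)) := by
  set X : Matrix m m 𝕜 := (hP.eigenvectorUnitary : Matrix m m 𝕜) with hX
  have h1 : Xᴴ * X = 1 := Unitary.coe_star_mul_self hP.eigenvectorUnitary
  have h := hP.spectral_theorem
  rw [Unitary.conjStarAlgAut_apply] at h
  have h' : P = X * diagonal (fun i => (hP.eigenvalues i : 𝕜)) * Xᴴ := h
  generalize diagonal (fun i => (hP.eigenvalues i : 𝕜)) = d at h' ⊢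
  calc Xᴴ * P * X = (Xᴴ * X) * d * (Xᴴ * X) := by
        conv_lhs => rw [h']
        simp only [Matrix.mul_assoc]
    _ = d := by rw [h1]; simp

theorem sqrt_ex {m : Type*} [Fintype m] [DecidableEq m] (P : Matrix m m ℝ) (hP : P.PosSemidef) :
    ∃ S : Matrix m m ℝ, S.PosSemidef ∧ S * S = P ∧ ∀ N : Matrix m m ℝ, N * P = P * N → N * S = S * N := by
  have hH := hP.isHermitian
  set X : Matrix m m ℝ := (hH.eigenvectorUnitary : Matrix m m ℝ) with hX
  have h1 : Xᴴ * X = 1 := Unitary.coe_star_mul_self hH.eigenvectorUnitary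
  have h2 : X * Xᴴ = 1 := Unitary.coe_mul_star_self hH.eigenvectorUnitary
  have hs : Xᴴ * P * X = diagonal hH.eigenvalues := by
    simpa using diag_ex P hH
  have hP' : P = X * diagonal hH.eigenvalues * Xᴴ := by
    rw [← hs]
    calc P = (X * Xᴴ) * P * (X * Xᴴ) := by rw [h2]; simp
      _ = _ := by simp only [Matrix.mul_assoc]
  refine ⟨X * diagonal (fun i => Real.sqrt (hH.eigenvalues i)) * Xᴴ, ?_, ?_, ?_⟩
  · apply PosSemidef.mul_mul_conjTranspose_same
    exact PosSemidef.diagonal (fun i => Real.sqrt_nonneg _)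
  · conv_rhs => rw [hP']
    have : ∀ d : Matrix m m ℝ, X * d * Xᴴ * (X * d * Xᴴ) = X * (d * d) * Xᴴ := by
      intro d
      calc _ = X * d * (Xᴴ * X) * d * Xᴴ := by simp only [Matrix.mul_assoc]
        _ = _ := by rw [h1]; simp only [Matrix.mul_assoc, Matrix.one_mul]
    rw [this, diagonal_mul_diagonal]
    congr; ext i; exact Real.mul_self_sqrt (hP.eigenvalues_nonneg i)
  · intro N hN
    set K := Xᴴ * N * X with hK
    have hN' : N = X * K * Xᴴ := by
      calc N = (X * Xᴴ) * N * (X * Xᴴ) := by rw [h2]; simp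
        _ = _ := by simp only [hK, Matrix.mul_assoc]
    have e1 : ∀ a b : Matrix m m ℝ, X * a * Xᴴ * (X * b * Xᴴ) = X * (a * b) * Xᴴ := by
      intro a d
      calc _ = X * a * (Xᴴ * X) * d * Xᴴ := by simp only [Matrix.mul_assoc]
        _ = _ := by rw [h1]; simp only [Matrix.mul_assoc, Matrix.one_mul]
    have hKd : K * diagonal hH.eigenvalues = diagonal hH.eigenvalues * K := by
      have e2 : ∀ a : Matrix m m ℝ, Xᴴ * (X * a * Xᴴ) * X = a := by
        intro a
        calc _ = (Xᴴ * X) * a * (Xᴴ * X) := by simp only [Matrix.mul_assoc]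
          _ = _ := by rw [h1]; simp
      have := hN
      rw [hN', hP', e1, e1] at this
      rw [← e2 (K * _), this, e2]
    rw [hN', e1, e1]
    congr 2
    ext i j
    have := congrFun (congrFun hKd i) j
    simp only [mul_diagonal, diagonal_mul] at this ⊢
    by_cases h : hH.eigenvalues i = hH.eigenvalues j
    · rw [h, mul_comm]
    · have : K i j = 0 := by
        have : (hH.eigenvalues i - hH.eigenvalues j) * K i j = 0 := by linarith
        rcases mul_eq_zero.1 this with h' | h'
        · exact absurd (sub_eq_zero.1 h') h
        · exact h'
      simp [this]

/-- Hermitian commuting with a real diagonal: diagonalised by a unitary commuting with it. -/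
theorem diag_comm {n : ℕ} (q : Fin n → ℝ) (T : Matrix (Fin n) (Fin n) ℂ) (hT : T.IsHermitian)
    (hc : T * diagonal (fun j => (q j : ℂ)) = diagonal (fun j => (q j : ℂ)) * T) :
    ∃ (V : Matrix (Fin n) (Fin n) ℂ) (a : Fin n → ℝ), Vᴴ * V = 1 ∧
      V * diagonal (fun j => (q j : ℂ)) = diagonal (fun j => (q j : ℂ)) * V ∧
      Vᴴ * T * V = diagonal (fun j => (a j : ℂ)) := by
  classical
  have hT0 : ∀ i j, q i ≠ q j → T i j = 0 := by
    intro i j h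
    have := congrFun (congrFun hc i) j
    simp only [mul_diagonal, diagonal_mul] at this
    have : ((q i : ℂ) - q j) * T i j = 0 := by rw [sub_mul, ← this]; ring
    rcases mul_eq_zero.1 this with h' | h'
    · exact absurd (by exact_mod_cast sub_eq_zero.1 h') h
    · exact h'
  let Tc : ∀ c : ℝ, Matrix {j // q j = c} {j // q j = c} ℂ := fun c => T.submatrix (·.1) (·.1)
  have hTc : ∀ c, (Tc c).IsHermitian := fun c => hT.submatrix _
  let Vc : ∀ c : ℝ, Matrix {j // q j = c} {j // q j = c} ℂ := fun c => (hTc c).eigenvectorUnitary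
  have h1 : ∀ c, (Vc c)ᴴ * Vc c = 1 := fun c => Unitary.coe_star_mul_self (hTc c).eigenvectorUnitary
  have hs : ∀ c, (Vc c)ᴴ * Tc c * Vc c = diagonal (fun j => (((hTc c).eigenvalues j : ℝ) : ℂ)) := by
    intro c
    simpa using diag_ex (Tc c) (hTc c)
  let V : Matrix (Fin n) (Fin n) ℂ := fun i j =>
    if h : q i = q j then Vc (q j) ⟨i, h⟩ ⟨j, rfl⟩ else 0
  have hV0 : ∀ i j, q i ≠ q j → V i j = 0 := fun i j h => by simp [V, h]
  have hV1 : ∀ c (i j : {j // q j = c}), V i.1 j.1 = Vc c i j := by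
    rintro c ⟨i, hi⟩ ⟨j, rfl⟩
    simp [V, hi]
  have hsum : ∀ (c : ℝ) (f : Fin n → ℂ), (∀ i, q i ≠ c → f i = 0) → ∑ i, f i = ∑ i : {j // q j = c}, f i.1 := by
    intro c f hf
    rw [← Finset.sum_subtype (Finset.univ.filter (fun j => q j = c)) (by simp) f]
    symm
    apply Finset.sum_filter_of_ne
    intro i _ h
    by_contra h'
    exact h (hf i h')
  let blk : Matrix (Fin n) (Fin n) ℂ → Prop := fun X => ∀ i j, q i ≠ q j → X i j = 0
  let sb : Matrix (Fin n) (Fin n) ℂ → ∀ c : ℝ, Matrix {j // q j = c} {j // q j = c} ℂ :=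
    fun X c => X.submatrix (·.1) (·.1)
  have hbm : ∀ X Y, blk X → blk Y → blk (X * Y) := by
    intro X Y hX hY i j h
    rw [mul_apply]
    apply Finset.sum_eq_zero
    intro k _
    by_cases h' : q i = q k
    · rw [hY k j (fun h2 => h (h'.trans h2)), mul_zero]
    · rw [hX i k h', zero_mul]
  have hsm : ∀ X Y, blk X → ∀ c, sb (X * Y) c = sb X c * sb Y c := by
    intro X Y hX c
    ext i j
    simp only [sb, submatrix_apply, mul_apply]
    apply hsum c (fun k => X i k * Y k j)
    intro k hk
    rw [hX i k (fun h => hk (h ▸ i.2)), zero_mul]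
  have hext : ∀ X Y, blk X → blk Y → (∀ c, sb X c = sb Y c) → X = Y := by
    intro X Y hX hY h
    ext i j
    by_cases h' : q i = q j
    · exact congrFun (congrFun (h (q j)) ⟨i, h'⟩) ⟨j, rfl⟩
    · rw [hX i j h', hY i j h']
  have hbd : ∀ d : Fin n → ℂ, blk (diagonal d) := fun d i j h =>
    diagonal_apply_ne _ (fun h' => h (congrArg q h'))
  have hsV : ∀ c, sb V c = Vc c := fun c => by ext i j; exact hV1 c i j
  have hbV' : blk Vᴴ := fun i j h => by
    rw [conjTranspose_apply, hV0 j i (Ne.symm h), star_zero]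
  have hsV' : ∀ c, sb Vᴴ c = (Vc c)ᴴ := fun c => by rw [← hsV c]; rfl
  refine ⟨V, fun j => (hTc (q j)).eigenvalues ⟨j, rfl⟩, ?_, ?_, ?_⟩
  · apply hext _ _ (hbm _ _ hbV' hV0)
    · rw [← diagonal_one]; exact hbd _
    · intro c
      rw [hsm _ _ hbV', hsV, hsV', h1]
      ext i j
      simp [sb, one_apply, Subtype.ext_iff]
  · ext i j
    simp only [mul_diagonal, diagonal_mul]
    by_cases h : q i = q j
    · rw [h, mul_comm]
    · simp [hV0 i j h]
  · apply hext _ _ (hbm _ _ (hbm _ _ hbV' hT0) hV0) (hbd _)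
    intro c
    rw [hsm _ _ (hbm _ _ hbV' hT0), hsm _ _ hbV', hsV, hsV']
    refine (hs c).trans ?_
    ext i ⟨j, hj⟩
    subst hj
    by_cases h : i = ⟨j, rfl⟩
    · subst h; simp [sb]
    · rw [diagonal_apply_ne _ h]
      simp only [sb, submatrix_apply]
      rw [diagonal_apply_ne]
      exact fun h' => h (Subtype.ext h')

theorem isUnit_of_li {n : ℕ} {X Y : Matrix (Fin n) (Fin n) ℂ} (h : X * Y = 1) : IsUnit Y :=
  ⟨⟨Y, X, mul_eq_one_comm.1 h, h⟩, rfl⟩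

section
open scoped ComplexOrder

/-- Joint congruence diagonalisation. -/
theorem cong_diag {n : ℕ} (q : Fin n → ℝ) (G T : Matrix (Fin n) (Fin n) ℂ) (hG : G.PosDef)
    (hT : T.PosDef)
    (hGc : G * diagonal (fun j => (q j : ℂ)) = diagonal (fun j => (q j : ℂ)) * G)
    (hTc : T * diagonal (fun j => (q j : ℂ)) = diagonal (fun j => (q j : ℂ)) * T) :
    ∃ (V : Matrix (Fin n) (Fin n) ℂ) (a : Fin n → ℝ), (∀ j, 0 < a j) ∧ Vᴴ * G * V = 1 ∧
      V * diagonal (fun j => (q j : ℂ)) = diagonal (fun j => (q j : ℂ)) * V ∧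
      Vᴴ * T * V = diagonal (fun j => (a j : ℂ)) := by
  obtain ⟨V1, g, h1, h2, h3⟩ := diag_comm q G hG.isHermitian hGc
  set D : Matrix (Fin n) (Fin n) ℂ := diagonal (fun j => (q j : ℂ)) with hD
  have inj : ∀ V : Matrix (Fin n) (Fin n) ℂ, IsUnit V → Function.Injective V.mulVec :=
    fun V hV => Matrix.mulVec_injective_of_isUnit hV
  have hV1u : IsUnit V1 := isUnit_of_li h1
  have hg : ∀ j, 0 < g j := by
    intro j
    have := (hG.conjTranspose_mul_mul_same (inj V1 hV1u)).diag_pos (i := j)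
    rw [h3, diagonal_apply_eq] at this
    exact_mod_cast this
  let E : Matrix (Fin n) (Fin n) ℂ := diagonal (fun j => (((Real.sqrt (g j))⁻¹ : ℝ) : ℂ))
  have hE : Eᴴ = E := by
    simp only [E, diagonal_conjTranspose]
    congr 1; ext j; simp
  have hEG : E * diagonal (fun j => (g j : ℂ)) * E = 1 := by
    simp only [E, diagonal_mul_diagonal]
    rw [← diagonal_one]
    congr 1; ext j
    have h0 : Real.sqrt (g j) ≠ 0 := (Real.sqrt_pos.2 (hg j)).ne'
    have hh : (Real.sqrt (g j))⁻¹ * g j * (Real.sqrt (g j))⁻¹ = 1 := by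
      field_simp
      rw [Real.sq_sqrt (hg j).le]
    exact_mod_cast hh
  have hEu : IsUnit E := isUnit_of_li hEG
  have hED : E * D = D * E := by
    simp only [E, hD, diagonal_mul_diagonal]
    congr 1; ext j; ring
  set V2 := V1 * E with hV2
  have hV2u : IsUnit V2 := hV1u.mul hEu
  have hV2G : V2ᴴ * G * V2 = 1 := by
    rw [hV2, conjTranspose_mul, hE, ← hEG, ← h3]
    simp only [Matrix.mul_assoc]
  have hV2D : V2 * D = D * V2 := by
    rw [hV2, Matrix.mul_assoc, hED, ← Matrix.mul_assoc, h2, Matrix.mul_assoc]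
  have hDh : Dᴴ = D := by
    simp only [hD, diagonal_conjTranspose]
    congr 1; ext j; simp
  clear_value V2 D
  have hV2D' : V2ᴴ * D = D * V2ᴴ := by
    have := congrArg conjTranspose hV2D
    rw [conjTranspose_mul, conjTranspose_mul, hDh] at this
    exact this.symm
  have hT2 : (V2ᴴ * T * V2).PosDef := hT.conjTranspose_mul_mul_same (inj V2 hV2u)
  obtain ⟨V3, a, k1, k2, k3⟩ := diag_comm q (V2ᴴ * T * V2) hT2.isHermitian (by
    rw [← hD]
    calc V2ᴴ * T * V2 * D = V2ᴴ * T * (V2 * D) := by simp only [Matrix.mul_assoc]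
      _ = V2ᴴ * (T * D) * V2 := by rw [hV2D]; simp only [Matrix.mul_assoc]
      _ = (V2ᴴ * D) * T * V2 := by rw [hTc]; simp only [Matrix.mul_assoc]
      _ = _ := by rw [hV2D']; simp only [Matrix.mul_assoc])
  have hV3u : IsUnit V3 := isUnit_of_li k1
  refine ⟨V2 * V3, a, ?_, ?_, ?_, ?_⟩
  · intro j
    have := (hT2.conjTranspose_mul_mul_same (inj V3 hV3u)).diag_pos (i := j)
    rw [k3, diagonal_apply_eq] at this
    exact_mod_cast this
  · rw [conjTranspose_mul]
    calc _ = V3ᴴ * (V2ᴴ * G * V2) * V3 := by simp only [Matrix.mul_assoc]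
      _ = 1 := by rw [hV2G, Matrix.mul_one, k1]
  · rw [← hD] at k2
    rw [Matrix.mul_assoc, k2, ← Matrix.mul_assoc, hV2D, Matrix.mul_assoc]
  · rw [conjTranspose_mul, ← k3]
    simp only [Matrix.mul_assoc]

theorem core {n : ℕ} {m : Type*} [Fintype m] [DecidableEq m] (q : Fin n → ℝ)
    (A M S : Matrix m m ℂ) (Z : Matrix m (Fin n) ℂ)
    (hAh : Aᴴ = -A) (hAt : Aᵀ = -A) (hMh : Mᴴ = -M) (hSt : Sᵀ = S) (hS : S.PosDef)
    (hSS : S * S = -(A * A)) (hSA : A * S = S * A) (hSM : M * S = S * M) (hAM : M * A = A * M)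
    (hZM : M * Z = Complex.I • (Z * diagonal (fun j => (q j : ℂ))))
    (hZA : Zᴴ * A * Z = (2 * Complex.I) • 1) :
    ∃ (W : Matrix m (Fin n) ℂ) (a : Fin n → ℝ), (∀ j, 0 < a j) ∧
      Wᴴ * W = 1 ∧ Wᵀ * W = 0 ∧ Wᴴ * A * W = Complex.I • diagonal (fun j => (a j : ℂ)) ∧
      Wᵀ * A * W = 0 ∧ M * W = Complex.I • (W * diagonal (fun j => (q j : ℂ))) := by
  set D : Matrix (Fin n) (Fin n) ℂ := diagonal (fun j => (q j : ℂ)) with hD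
  have hDh : Dᴴ = D := by
    simp only [hD, diagonal_conjTranspose]
    congr 1; ext j; simp
  have hI := Complex.I_mul_I
  set R := S - Complex.I • A with hR
  have hRt : Rᵀ = S + Complex.I • A := by
    rw [hR, transpose_sub, transpose_smul, hSt, hAt]; simp
  have hRR : Rᵀ * R = 0 := by
    rw [hRt, hR]
    simp only [add_mul, mul_sub, smul_mul_assoc, mul_smul_comm, hSS, hSA]
    have h3 : Complex.I • Complex.I • (A * A) = -(A * A) := by rw [smul_smul, hI, neg_one_smul]
    rw [smul_add, h3]
    abel
  have hAR : A * R = R * A := by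
    rw [hR]; simp only [mul_sub, sub_mul, smul_mul_assoc, mul_smul_comm, hSA]
  have hMR : M * R = R * M := by
    rw [hR]; simp only [mul_sub, sub_mul, smul_mul_assoc, mul_smul_comm, hSM, hAM]
  have hAR2 : A * R = Complex.I • (S * R) := by
    rw [hR]; simp only [mul_sub, smul_sub, mul_smul_comm, smul_smul, hSS, hSA, hI]
    module
  set U := R * Z with hU
  have hUU : Uᵀ * U = 0 := by
    rw [hU, transpose_mul]
    calc _ = Zᵀ * (Rᵀ * R) * Z := by simp only [Matrix.mul_assoc]
      _ = 0 := by rw [hRR]; simp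
  have hUAU : Uᵀ * A * U = 0 := by
    rw [hU, transpose_mul]
    calc _ = Zᵀ * (Rᵀ * (A * R)) * Z := by simp only [Matrix.mul_assoc]
      _ = Zᵀ * (Rᵀ * R * A) * Z := by rw [hAR]; simp only [Matrix.mul_assoc]
      _ = 0 := by rw [hRR]; simp
  have hAU : A * U = Complex.I • (S * U) := by
    rw [hU, ← Matrix.mul_assoc, hAR2, Matrix.smul_mul, Matrix.mul_assoc]
  have hMU : M * U = Complex.I • (U * D) := by
    rw [hU, ← Matrix.mul_assoc, hMR, Matrix.mul_assoc, hZM, Matrix.mul_smul, Matrix.mul_assoc]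
  clear_value U
  have hMU' : Uᴴ * M = Complex.I • (D * Uᴴ) := by
    have := congrArg conjTranspose hMU
    rw [conjTranspose_mul, conjTranspose_smul, conjTranspose_mul, hMh, hDh] at this
    simpa using this
  have hinj : Function.Injective U.mulVec := by
    rw [← Matrix.coe_mulVecLin, injective_iff_map_eq_zero]
    intro x hx
    rw [Matrix.mulVecLin_apply] at hx
    have e1 : (Zᴴ * S * Z) *ᵥ x = (-2 : ℂ) • x := by
      have : Zᴴ * S * Z = Zᴴ * U + Complex.I • (Zᴴ * A * Z) := by
        rw [hU, hR]; simp only [Matrix.sub_mul, Matrix.mul_sub, Matrix.smul_mul, Matrix.mul_smul, Matrix.mul_assoc]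
        simp
      rw [this, hZA, smul_smul, add_mulVec, ← mulVec_mulVec, hx, mulVec_zero, zero_add, smul_mulVec, one_mulVec]
      congr 1
      linear_combination 2 * hI
    have e2 := (hS.posSemidef.conjTranspose_mul_mul_same Z).dotProduct_mulVec_nonneg x
    rw [e1, dotProduct_smul, smul_eq_mul] at e2
    have e3 : (0 : ℂ) ≤ star x ⬝ᵥ x := dotProduct_star_self_nonneg x
    have e4 : star x ⬝ᵥ x = 0 := by
      apply le_antisymm _ e3
      rw [Complex.le_def] at e2 e3 ⊢
      simp at e2 e3 ⊢
      constructor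
      · linarith [e2.1]
      · exact e3.2.symm
    exact dotProduct_star_self_eq_zero.1 e4
  have cancelI : ∀ X Y : Matrix (Fin n) (Fin n) ℂ, Complex.I • X = Complex.I • Y → X = Y :=
    fun X Y h => smul_right_injective _ Complex.I_ne_zero h
  obtain ⟨V, a, ha, hVG, hVD, hVT⟩ := cong_diag q (Uᴴ * U) (Uᴴ * S * U)
    (PosDef.conjTranspose_mul_self U hinj) (hS.conjTranspose_mul_mul_same hinj)
    (by
      rw [← hD]
      apply cancelI
      calc Complex.I • (Uᴴ * U * D) = Uᴴ * (M * U) := by rw [hMU, Matrix.mul_smul, Matrix.mul_assoc]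
        _ = (Uᴴ * M) * U := by rw [Matrix.mul_assoc]
        _ = _ := by rw [hMU', Matrix.smul_mul, Matrix.mul_assoc])
    (by
      rw [← hD]
      apply cancelI
      calc Complex.I • (Uᴴ * S * U * D) = Uᴴ * S * (M * U) := by rw [hMU, Matrix.mul_smul, Matrix.mul_assoc _ U D]
        _ = Uᴴ * (S * M) * U := by simp only [Matrix.mul_assoc]
        _ = (Uᴴ * M) * S * U := by rw [← hSM]; simp only [Matrix.mul_assoc]
        _ = _ := by rw [hMU']; simp only [Matrix.smul_mul, Matrix.mul_assoc])
  refine ⟨U * V, a, ha, ?_, ?_, ?_, ?_, ?_⟩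
  · rw [← hVG, conjTranspose_mul]; simp only [Matrix.mul_assoc]
  · rw [transpose_mul]
    calc _ = Vᵀ * (Uᵀ * U) * V := by simp only [Matrix.mul_assoc]
      _ = 0 := by rw [hUU]; simp
  · rw [conjTranspose_mul, ← hVT]
    calc _ = Vᴴ * (Uᴴ * (A * U)) * V := by simp only [Matrix.mul_assoc]
      _ = _ := by rw [hAU]; simp only [Matrix.mul_smul, Matrix.smul_mul, Matrix.mul_assoc]
  · rw [transpose_mul]
    calc _ = Vᵀ * (Uᵀ * A * U) * V := by simp only [Matrix.mul_assoc]
      _ = 0 := by rw [hUAU]; simp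
  · rw [← Matrix.mul_assoc, hMU, Matrix.smul_mul, Matrix.mul_assoc, hD, ← hVD, Matrix.mul_assoc]

end

/-- The real matrix built from complex columns. -/
def realify {n : ℕ} {m : Type*} (W : Matrix m (Fin n) ℂ) : Matrix (Fin 2 × Fin n) m ℝ :=
  fun p x => Real.sqrt 2 * (if p.1 = 0 then (W x p.2).re else (W x p.2).im)

theorem realify_conj {n : ℕ} {m : Type*} [Fintype m] [DecidableEq m] (W : Matrix m (Fin n) ℂ)
    (N : Matrix m m ℝ) (c : Fin n → ℂ)
    (h1 : Wᴴ * N.map Complex.ofReal * W = diagonal c) (h2 : Wᵀ * N.map Complex.ofReal * W = 0) :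
    realify W * N * (realify W)ᵀ =
      blockDiagonal (fun j => !![(c j).re, (c j).im; -(c j).im, (c j).re]) := by
  have s2 : Real.sqrt 2 * Real.sqrt 2 = 2 := Real.mul_self_sqrt (by norm_num)
  have key : ∀ (f g : ℂ → ℝ) (j k : Fin n),
      ∑ y, (∑ x, Real.sqrt 2 * f (W x j) * N x y) * (Real.sqrt 2 * g (W y k)) =
      2 * ∑ y, ∑ x, f (W x j) * N x y * g (W y k) := by
    intro f g j k
    rw [Finset.mul_sum]
    refine Finset.sum_congr rfl fun y _ => ?_
    rw [Finset.sum_mul, Finset.mul_sum]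
    refine Finset.sum_congr rfl fun x _ => ?_
    linear_combination (f (W x j) * N x y * g (W y k)) * s2
  have a1 : ∀ j k, ∑ y, ∑ x, star (W x j) * (N x y : ℂ) * W y k = diagonal c j k := by
    intro j k
    rw [← h1, mul_apply]
    simp only [mul_apply, conjTranspose_apply, map_apply, Finset.sum_mul]
  have a2 : ∀ j k, ∑ y, ∑ x, (W x j) * (N x y : ℂ) * W y k = 0 := by
    intro j k
    rw [← zero_apply (α := ℂ) j k, ← h2, mul_apply]
    simp only [mul_apply, transpose_apply, map_apply, Finset.sum_mul]
  have b1 := fun j k => congrArg Complex.re (a1 j k)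
  have b2 := fun j k => congrArg Complex.im (a1 j k)
  have b3 := fun j k => congrArg Complex.re (a2 j k)
  have b4 := fun j k => congrArg Complex.im (a2 j k)
  simp only [Complex.re_sum, Complex.im_sum, Complex.mul_re, Complex.mul_im, Complex.star_def,
    Complex.conj_re, Complex.conj_im, Complex.ofReal_re, Complex.ofReal_im, mul_zero, zero_add, sub_zero,
    neg_mul, Finset.sum_add_distrib, Finset.sum_sub_distrib, Finset.sum_neg_distrib,
    Complex.zero_re, Complex.zero_im] at b1 b2 b3 b4
  have cre : ∀ j k, (diagonal c j k).re = if j = k then (c j).re else 0 := by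
    intro j k; rw [diagonal_apply]; split_ifs <;> simp
  have cim : ∀ j k, (diagonal c j k).im = if j = k then (c j).im else 0 := by
    intro j k; rw [diagonal_apply]; split_ifs <;> simp
  ext ⟨α, j⟩ ⟨β, k⟩
  have B1 := b1 j k
  have B2 := b2 j k
  have B3 := b3 j k
  have B4 := b4 j k
  rw [cre] at B1
  rw [cim] at B2
  rw [blockDiagonal_apply, mul_apply]
  simp only [mul_apply, transpose_apply, realify]
  fin_cases α <;> fin_cases β
  · simp
    rw [key Complex.re Complex.re]
    split_ifs at * <;> linarith
  · simp
    rw [key Complex.re Complex.im]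
    split_ifs at * <;> linarith
  · simp
    rw [key Complex.im Complex.re]
    split_ifs at * <;> linarith
  · simp
    rw [key Complex.im Complex.im]
    split_ifs at * <;> linarith

/-- The complex columns `e_{0j} + i e_{1j}`. -/
def W0 (n : ℕ) : Matrix (Fin 2 × Fin n) (Fin n) ℂ :=
  fun p j => if p.2 = j then (if p.1 = 0 then 1 else Complex.I) else 0

theorem Om_W0 (n : ℕ) : (OmegaN n).map Complex.ofReal * W0 n = Complex.I • W0 n := by
  ext ⟨α, k⟩ j
  rw [mul_apply, Fintype.sum_prod_type, Matrix.smul_apply]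
  simp only [map_apply, OmegaN, blockDiagonal_apply, W0]
  fin_cases α <;> by_cases h : k = j <;> simp [h, Omega1]

theorem Q_W0 {n : ℕ} (q : Fin n → ℝ) : (QMat q).map Complex.ofReal * W0 n =
    W0 n * diagonal (fun j => (q j : ℂ)) := by
  ext ⟨α, k⟩ j
  rw [mul_apply, Fintype.sum_prod_type, mul_diagonal]
  simp only [map_apply, QMat, blockDiagonal_apply, W0]
  fin_cases α <;> by_cases h : k = j <;> simp [h, mul_comm]

theorem W0_W0 (n : ℕ) : (W0 n)ᴴ * W0 n = (2 : ℂ) • 1 := by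
  ext i j
  rw [mul_apply, Fintype.sum_prod_type, Matrix.smul_apply, one_apply]
  simp only [conjTranspose_apply, W0]
  by_cases h : i = j
  · subst h; simp; norm_num
  · simp [h, Ne.symm h]

theorem Om_t (n : ℕ) : (OmegaN n)ᵀ = -OmegaN n := by
  rw [OmegaN, blockDiagonal_transpose, ← blockDiagonal_neg]
  congr 1; ext k i j; fin_cases i <;> fin_cases j <;> simp [Omega1]

theorem Q_t {n : ℕ} (q : Fin n → ℝ) : (QMat q)ᵀ = QMat q := by
  rw [QMat, blockDiagonal_transpose]
  congr 1; ext k i j; fin_cases i <;> fin_cases j <;> simp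

theorem Om_Q {n : ℕ} (q : Fin n → ℝ) : OmegaN n * QMat q = QMat q * OmegaN n := by
  rw [QMat, OmegaN, ← blockDiagonal_mul, ← blockDiagonal_mul]
  congr 1; ext k : 1; simp

theorem Om_Om (n : ℕ) : OmegaN n * OmegaN n = -1 := by
  rw [OmegaN, ← blockDiagonal_mul, ← blockDiagonal_one, ← blockDiagonal_neg]
  congr 1; ext k i j; fin_cases i <;> fin_cases j <;> simp [Omega1]

/-- Entrywise complexification. -/
abbrev cx {m k : Type*} (X : Matrix m k ℝ) : Matrix m k ℂ := X.map Complex.ofReal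

theorem cx_mul {m k l : Type*} [Fintype k] (X : Matrix m k ℝ) (Y : Matrix k l ℝ) :
    cx (X * Y) = cx X * cx Y := by
  ext i j; simp [mul_apply]

theorem cx_neg {m k : Type*} (X : Matrix m k ℝ) : cx (-X) = -cx X := by
  ext i j; simp

theorem cx_one {m : Type*} [DecidableEq m] : cx (1 : Matrix m m ℝ) = 1 := by
  ext i j; simp [one_apply]; split_ifs <;> simp

theorem cx_h {m k : Type*} (X : Matrix m k ℝ) : (cx X)ᴴ = cx Xᵀ := by
  ext i j; simp

theorem cx_t {m k : Type*} (X : Matrix m k ℝ) : (cx X)ᵀ = cx Xᵀ := by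
  ext i j; simp

open scoped ComplexOrder in
theorem cx_posDef {m : Type*} [Fintype m] [DecidableEq m] (S : Matrix m m ℝ)
    (h : S.PosSemidef) (hu : IsUnit S) : (cx S).PosDef := by
  obtain ⟨R, -, hR, -⟩ := sqrt_ex S h
  have hR' : ∃ C : Matrix m m ℝ, S = Cᵀ * C := by
    obtain ⟨R, hR0, hR, -⟩ := sqrt_ex S h
    refine ⟨R, ?_⟩
    have : Rᵀ = R := by simpa using hR0.isHermitian.eq
    rw [this, hR]
  obtain ⟨C, hC⟩ := hR'
  have hps : (cx S).PosSemidef := by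
    rw [hC, cx_mul, ← cx_h]
    exact posSemidef_conjTranspose_mul_self _
  rw [hps.posDef_iff_isUnit]
  obtain ⟨⟨u, v, h1, h2⟩, rfl⟩ := hu
  exact ⟨⟨cx u, cx v, by rw [← cx_mul, h1, cx_one], by rw [← cx_mul, h2, cx_one]⟩, rfl⟩

/-- Lemma E.1: for a real symmetric positive-definite `B` commuting with `Ω_n * Q`,
the antisymmetric matrix `A = B * Ω_n * B` can be brought to canonical block form
`blockdiag(a_j · Ω₁)` with `a_j > 0` by an orthogonal matrix commuting with `Ω_n * Q`. -/
theorem lemmaE1 (n : ℕ) (q : Fin n → ℝ)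
    (B : Matrix (Fin 2 × Fin n) (Fin 2 × Fin n) ℝ)
    (hBsymm : B.IsSymm) (hBpd : B.PosDef)
    (hBcomm : B * (OmegaN n * QMat q) = (OmegaN n * QMat q) * B) :
    ∃ O : Matrix (Fin 2 × Fin n) (Fin 2 × Fin n) ℝ,
      O * Oᵀ = 1 ∧
      O * (OmegaN n * QMat q) = (OmegaN n * QMat q) * O ∧
      ∃ a : Fin n → ℝ, (∀ j, 0 < a j) ∧
        O * (B * OmegaN n * B) * Oᵀ = Matrix.blockDiagonal (fun j => (a j) • Omega1) := by
  classical
  set M := OmegaN n * QMat q with hM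
  set A := B * OmegaN n * B with hA
  have hBt : Bᵀ = B := hBsymm
  have hOM : OmegaN n * M = M * OmegaN n := by
    rw [hM, Om_Q, ← Matrix.mul_assoc, Om_Q]
  have hMt : Mᵀ = -M := by
    rw [hM, transpose_mul, Om_t, Q_t, Om_Q, Matrix.mul_neg]
  have hAt : Aᵀ = -A := by
    rw [hA, transpose_mul, transpose_mul, hBt, Om_t]
    simp [Matrix.mul_assoc]
  have hMA : M * A = A * M := by
    rw [hA]
    calc M * (B * OmegaN n * B) = (M * B) * OmegaN n * B := by simp only [Matrix.mul_assoc]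
      _ = B * (M * OmegaN n) * B := by rw [← hBcomm]; simp only [Matrix.mul_assoc]
      _ = B * OmegaN n * (M * B) := by rw [← hOM]; simp only [Matrix.mul_assoc]
      _ = _ := by rw [← hBcomm]; simp only [Matrix.mul_assoc]
  have hBu : IsUnit B := hBpd.isUnit
  have hBd : IsUnit B.det := (Matrix.isUnit_iff_isUnit_det B).1 hBu
  have hBi1 : B * B⁻¹ = 1 := Matrix.mul_nonsing_inv B hBd
  have hBi2 : B⁻¹ * B = 1 := Matrix.nonsing_inv_mul B hBd
  have hOu : IsUnit (OmegaN n) :=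
    ⟨⟨OmegaN n, -OmegaN n, by rw [mul_neg, Om_Om, neg_neg], by rw [neg_mul, Om_Om, neg_neg]⟩, rfl⟩
  have hAu : IsUnit A := (hBu.mul hOu).mul hBu
  obtain ⟨S, hS, hSS, hSc⟩ := sqrt_ex (Aᵀ * A) (by
    have := posSemidef_conjTranspose_mul_self A
    simpa using this)
  rw [hAt, neg_mul] at hSS
  have hSu : IsUnit S := by
    have : IsUnit (S * S) := by rw [hSS]; exact (hAu.mul hAu).neg
    rw [Matrix.isUnit_iff_isUnit_det, det_mul] at this
    rw [Matrix.isUnit_iff_isUnit_det]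
    exact isUnit_of_mul_isUnit_left this
  have hSt : Sᵀ = S := by simpa using hS.isHermitian.eq
  have hSA : A * S = S * A := hSc A (by rw [hAt]; simp [Matrix.mul_assoc])
  have hSM : M * S = S * M := hSc M (by
    rw [hAt, neg_mul, mul_neg, neg_mul, ← Matrix.mul_assoc, hMA, Matrix.mul_assoc A M A, hMA, Matrix.mul_assoc A A M])
  have hMBi : M * B⁻¹ = B⁻¹ * M := by
    calc M * B⁻¹ = (B⁻¹ * B) * M * B⁻¹ := by rw [hBi2, Matrix.one_mul]
      _ = B⁻¹ * (B * M) * B⁻¹ := by simp only [Matrix.mul_assoc]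
      _ = B⁻¹ * M * (B * B⁻¹) := by rw [hBcomm]; simp only [Matrix.mul_assoc]
      _ = _ := by rw [hBi1, Matrix.mul_one]
  have hBit : (B⁻¹)ᵀ = B⁻¹ := by rw [transpose_nonsing_inv, hBt]
  have hBAB : B⁻¹ * A * B⁻¹ = OmegaN n := by
    calc B⁻¹ * A * B⁻¹ = (B⁻¹ * B) * OmegaN n * (B * B⁻¹) := by rw [hA]; simp only [Matrix.mul_assoc]
      _ = _ := by rw [hBi1, hBi2, Matrix.mul_one, Matrix.one_mul]
  obtain ⟨W, a, ha, w1, w2, w3, w4, w5⟩ := core q (cx A) (cx M) (cx S) (cx B⁻¹ * W0 n)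
    (by rw [cx_h, hAt, cx_neg]) (by rw [cx_t, hAt, cx_neg]) (by rw [cx_h, hMt, cx_neg])
    (by rw [cx_t, hSt]) (cx_posDef S hS hSu) (by rw [← cx_mul, hSS, cx_neg, cx_mul])
    (by rw [← cx_mul, hSA, cx_mul]) (by rw [← cx_mul, hSM, cx_mul]) (by rw [← cx_mul, hMA, cx_mul])
    (by
      rw [← Matrix.mul_assoc, ← cx_mul, hMBi, cx_mul, Matrix.mul_assoc, hM, cx_mul,
        Matrix.mul_assoc (cx (OmegaN n)), Q_W0, ← Matrix.mul_assoc (cx (OmegaN n)), Om_W0,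
        Matrix.smul_mul, Matrix.mul_smul, Matrix.mul_assoc])
    (by
      rw [conjTranspose_mul, cx_h, hBit]
      calc _ = (W0 n)ᴴ * (cx B⁻¹ * cx A * cx B⁻¹) * W0 n := by simp only [Matrix.mul_assoc]
        _ = _ := by
          rw [← cx_mul, ← cx_mul, hBAB, Matrix.mul_assoc, Om_W0, Matrix.mul_smul, W0_W0, smul_smul,
            mul_comm])
  have r1 := realify_conj W 1 (fun _ => 1)
    (by rw [show (1 : Matrix (Fin 2 × Fin n) (Fin 2 × Fin n) ℝ).map Complex.ofReal = 1 from cx_one,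
          Matrix.mul_one, w1, diagonal_one])
    (by rw [show (1 : Matrix (Fin 2 × Fin n) (Fin 2 × Fin n) ℝ).map Complex.ofReal = 1 from cx_one,
          Matrix.mul_one, w2])
  have r2 := realify_conj W A (fun j => Complex.I * a j)
    (by rw [w3, ← diagonal_smul]; rfl) w4
  have r3 := realify_conj W M (fun j => Complex.I * q j)
    (by rw [Matrix.mul_assoc, w5, Matrix.mul_smul, ← Matrix.mul_assoc, w1, Matrix.one_mul,
          ← diagonal_smul]; rfl)
    (by rw [Matrix.mul_assoc, w5, Matrix.mul_smul, ← Matrix.mul_assoc, w2, Matrix.zero_mul, smul_zero])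
  set O := realify W with hO
  have o1 : O * Oᵀ = 1 := by
    rw [Matrix.mul_one] at r1
    rw [r1, ← blockDiagonal_one]
    congr 1; ext k i j; fin_cases i <;> fin_cases j <;> simp
  have o2 : Oᵀ * O = 1 := mul_eq_one_comm.1 o1
  have o3 : O * M * Oᵀ = M := by
    rw [r3, hM, OmegaN, QMat, ← blockDiagonal_mul]
    congr 1; ext k i j; fin_cases i <;> fin_cases j <;> simp [Omega1]
  refine ⟨O, o1, ?_, a, ha, ?_⟩
  · calc O * M = O * M * (Oᵀ * O) := by rw [o2, Matrix.mul_one]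
      _ = (O * M * Oᵀ) * O := by simp only [Matrix.mul_assoc]
      _ = M * O := by rw [o3]
  · rw [r2]
    congr 1; ext k i j; fin_cases i <;> fin_cases j <;> simp [Omega1]
end
end

section
/- Proposition 3.2(ii) (uniqueness of the passive form up to orthogonal symplectic conjugation): Let G be a group and S : G → Matrix (2n×2n) ℝ a group homomorphism such that every S(g) is symplectic. Suppose R and R̃ are symplectic matrices such that O(g) := R⁻¹ * S(g) * R is orthogonal for every g ∈ G and Õ(g) := R̃⁻¹ * S(g) * R̃ is orthogonal for every g ∈ G. Then there exists a matrix T that is both orthogonal and symplectic such that Õ(g) = T * O(g) * Tᵀ for all g ∈ G. -/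
open Matrix

noncomputable section

/-- A real 2n×2n matrix is symplectic if `S * Ω_n * Sᵀ = Ω_n`. -/
def IsSymplectic {n : ℕ} (S : Matrix (Fin 2 × Fin n) (Fin 2 × Fin n) ℝ) : Prop :=
  S * OmegaN n * Sᵀ = OmegaN n

open scoped MatrixOrder in
lemma psd_sq_unique {ι : Type*} [Fintype ι] [DecidableEq ι] {P Q : Matrix ι ι ℝ}
    (hP : P.PosSemidef) (hQ : Q.PosSemidef) (h : P * P = Q * Q) : P = Q :=
  (CFC.mul_self_eq_mul_self_iff P Q hP.nonneg hQ.nonneg).1 h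

open scoped MatrixOrder in
lemma exists_psd_sqrt {ι : Type*} [Fintype ι] [DecidableEq ι] {A : Matrix ι ι ℝ}
    (hA : A.PosSemidef) : ∃ P : Matrix ι ι ℝ, P.PosSemidef ∧ P * P = A :=
  ⟨CFC.sqrt A, (CFC.sqrt_nonneg A).posSemidef, CFC.sqrt_mul_sqrt_self A hA.nonneg⟩

lemma OmegaN_transpose (n : ℕ) : (OmegaN n)ᵀ = - OmegaN n := by
  have h : Omega1ᵀ = - Omega1 := by
    ext i j; fin_cases i <;> fin_cases j <;> simp [Omega1]
  rw [OmegaN, Matrix.blockDiagonal_transpose, ← Matrix.blockDiagonal_neg]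
  simp only [h]
  rfl

lemma OmegaN_mul_transpose (n : ℕ) : OmegaN n * (OmegaN n)ᵀ = 1 := by
  have h : Omega1 * Omega1ᵀ = 1 := by
    ext i j; fin_cases i <;> fin_cases j <;> simp [Omega1, Matrix.mul_apply, Fin.sum_univ_two, -Matrix.cons_mul]
  rw [OmegaN, Matrix.blockDiagonal_transpose, ← Matrix.blockDiagonal_mul]
  simp only [h]
  exact Matrix.blockDiagonal_one

lemma IsSymplectic.right_inv {n : ℕ} {M : Matrix (Fin 2 × Fin n) (Fin 2 × Fin n) ℝ}
    (h : IsSymplectic M) : M * (OmegaN n * Mᵀ * (OmegaN n)ᵀ) = 1 := by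
  have h' : M * OmegaN n * Mᵀ = OmegaN n := h
  calc M * (OmegaN n * Mᵀ * (OmegaN n)ᵀ) = (M * OmegaN n * Mᵀ) * (OmegaN n)ᵀ := by
        simp only [Matrix.mul_assoc]
    _ = 1 := by rw [h', OmegaN_mul_transpose]

lemma IsSymplectic.inv_mul {n : ℕ} {M : Matrix (Fin 2 × Fin n) (Fin 2 × Fin n) ℝ}
    (h : IsSymplectic M) : M⁻¹ * M = 1 :=
  Matrix.nonsing_inv_mul _ ((Matrix.isUnit_iff_isUnit_det M).1
    (IsUnit.of_mul_eq_one _ h.right_inv))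

lemma IsSymplectic.transpose {n : ℕ} {M : Matrix (Fin 2 × Fin n) (Fin 2 × Fin n) ℝ}
    (h : IsSymplectic M) : Mᵀ * OmegaN n * M = OmegaN n := by
  have h1 : OmegaN n * Mᵀ * (OmegaN n)ᵀ * M = 1 := mul_eq_one_comm.1 h.right_inv
  have hW : (OmegaN n)ᵀ * OmegaN n = 1 := mul_eq_one_comm.1 (OmegaN_mul_transpose n)
  have h2 : Mᵀ * (OmegaN n)ᵀ * M = (OmegaN n)ᵀ := by
    calc Mᵀ * (OmegaN n)ᵀ * M
        = ((OmegaN n)ᵀ * OmegaN n) * (Mᵀ * (OmegaN n)ᵀ * M) := by rw [hW, Matrix.one_mul]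
      _ = (OmegaN n)ᵀ * (OmegaN n * Mᵀ * (OmegaN n)ᵀ * M) := by simp only [Matrix.mul_assoc]
      _ = (OmegaN n)ᵀ := by rw [h1, Matrix.mul_one]
  rw [OmegaN_transpose] at h2
  simpa using h2

lemma IsSymplectic.inv {n : ℕ} {M : Matrix (Fin 2 × Fin n) (Fin 2 × Fin n) ℝ}
    (h : IsSymplectic M) : IsSymplectic M⁻¹ := by
  have h' : M * OmegaN n * Mᵀ = OmegaN n := h
  have h1 := h.inv_mul
  have h2 : Mᵀ * (M⁻¹)ᵀ = 1 := by rw [← Matrix.transpose_mul, h1, Matrix.transpose_one]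
  show M⁻¹ * OmegaN n * (M⁻¹)ᵀ = OmegaN n
  calc M⁻¹ * OmegaN n * (M⁻¹)ᵀ = M⁻¹ * (M * OmegaN n * Mᵀ) * (M⁻¹)ᵀ := by rw [h']
    _ = (M⁻¹ * M) * OmegaN n * (Mᵀ * (M⁻¹)ᵀ) := by simp only [Matrix.mul_assoc]
    _ = OmegaN n := by rw [h1, h2, Matrix.one_mul, Matrix.mul_one]

lemma IsSymplectic.mul {n : ℕ} {M N : Matrix (Fin 2 × Fin n) (Fin 2 × Fin n) ℝ}
    (h : IsSymplectic M) (k : IsSymplectic N) : IsSymplectic (M * N) := by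
  have h' : M * OmegaN n * Mᵀ = OmegaN n := h
  have k' : N * OmegaN n * Nᵀ = OmegaN n := k
  show M * N * OmegaN n * (M * N)ᵀ = OmegaN n
  calc M * N * OmegaN n * (M * N)ᵀ = M * (N * OmegaN n * Nᵀ) * Mᵀ := by
        rw [Matrix.transpose_mul]; simp only [Matrix.mul_assoc]
    _ = OmegaN n := by rw [k', h']

/-- The orthogonal polar factor of a symplectic matrix is symplectic and
intertwines whatever orthogonal matrices the matrix itself intertwines. -/
lemma polar_symplectic {n : ℕ} {M : Matrix (Fin 2 × Fin n) (Fin 2 × Fin n) ℝ}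
    (hM : IsSymplectic M) :
    ∃ T : Matrix (Fin 2 × Fin n) (Fin 2 × Fin n) ℝ,
      T * Tᵀ = 1 ∧ IsSymplectic T ∧
      ∀ U V : Matrix (Fin 2 × Fin n) (Fin 2 × Fin n) ℝ, U * Uᵀ = 1 → V * Vᵀ = 1 →
        M * U = V * M → V = T * U * Tᵀ := by
  have hM' : M * OmegaN n * Mᵀ = OmegaN n := hM
  have hMt := hM.transpose
  have hW := OmegaN_mul_transpose n
  have hW' : (OmegaN n)ᵀ * OmegaN n = 1 := mul_eq_one_comm.1 hW
  have hiM := hM.inv_mul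
  obtain ⟨P, hP, hPA⟩ := exists_psd_sqrt (A := Mᵀ * M)
    (by simpa using Matrix.posSemidef_conjTranspose_mul_self M)
  have hPt : Pᵀ = P := by simpa using hP.1.eq
  have hPu : P * (P * (M⁻¹ * (M⁻¹)ᵀ)) = 1 := by
    have h2 : Mᵀ * (M⁻¹)ᵀ = 1 := by rw [← Matrix.transpose_mul, hiM, Matrix.transpose_one]
    have h3 : M * M⁻¹ = 1 := mul_eq_one_comm.1 hiM
    calc P * (P * (M⁻¹ * (M⁻¹)ᵀ)) = (P * P) * (M⁻¹ * (M⁻¹)ᵀ) := by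
          simp only [Matrix.mul_assoc]
      _ = Mᵀ * (M * M⁻¹) * (M⁻¹)ᵀ := by rw [hPA]; simp only [Matrix.mul_assoc]
      _ = 1 := by rw [h3, Matrix.mul_one, h2]
  have hPQ : P * P⁻¹ = 1 := Matrix.mul_nonsing_inv _ ((Matrix.isUnit_iff_isUnit_det P).1
    (IsUnit.of_mul_eq_one _ hPu))
  have hQ : (P⁻¹).PosSemidef := hP.inv
  generalize P⁻¹ = Q at hPQ hQ
  have hQP : Q * P = 1 := mul_eq_one_comm.1 hPQ
  have hQt : Qᵀ = Q := by simpa using hQ.1.eq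
  -- the conjugate of P by Omega is Q
  have hconj : OmegaN n * P * (OmegaN n)ᵀ = Q := by
    refine psd_sq_unique (by simpa using hP.mul_mul_conjTranspose_same (OmegaN n)) hQ ?_
    have e1 : OmegaN n * P * (OmegaN n)ᵀ * (OmegaN n * P * (OmegaN n)ᵀ)
        = OmegaN n * (P * P) * (OmegaN n)ᵀ := by
      calc _ = OmegaN n * P * ((OmegaN n)ᵀ * OmegaN n) * P * (OmegaN n)ᵀ := by
            simp only [Matrix.mul_assoc]
        _ = _ := by rw [hW']; simp only [Matrix.mul_assoc, Matrix.one_mul]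
    have e2 : (P * P) * (OmegaN n * (P * P) * (OmegaN n)ᵀ) = 1 := by
      rw [hPA]
      calc _ = Mᵀ * (M * OmegaN n * Mᵀ) * M * (OmegaN n)ᵀ := by simp only [Matrix.mul_assoc]
        _ = 1 := by rw [hM', hMt, hW]
    have e3 : (Q * Q) * (P * P) = 1 := by
      calc _ = Q * (Q * P) * P := by simp only [Matrix.mul_assoc]
        _ = 1 := by rw [hQP, Matrix.mul_one, hQP]
    rw [e1]
    exact (left_inv_eq_right_inv e3 e2).symm
  have hQW : Q * OmegaN n * Q = OmegaN n := by
    rw [← hconj]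
    calc _ = OmegaN n * P * ((OmegaN n)ᵀ * OmegaN n) * (OmegaN n * P * (OmegaN n)ᵀ) := by
          simp only [Matrix.mul_assoc]
      _ = OmegaN n * (P * Q) := by
          rw [hW', hconj]; simp only [Matrix.mul_assoc, Matrix.one_mul]
      _ = OmegaN n := by rw [hPQ, Matrix.mul_one]
  have hTT : (M * Q) * (M * Q)ᵀ = 1 := by
    apply mul_eq_one_comm.1
    rw [Matrix.transpose_mul, hQt]
    calc _ = Q * (Mᵀ * M) * Q := by simp only [Matrix.mul_assoc]
      _ = (Q * P) * (P * Q) := by rw [← hPA]; simp only [Matrix.mul_assoc]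
      _ = 1 := by rw [hQP, hPQ, Matrix.mul_one]
  refine ⟨M * Q, hTT, ?_, ?_⟩
  · show M * Q * OmegaN n * (M * Q)ᵀ = OmegaN n
    rw [Matrix.transpose_mul, hQt]
    calc _ = M * (Q * OmegaN n * Q) * Mᵀ := by simp only [Matrix.mul_assoc]
      _ = _ := by rw [hQW, hM']
  · intro U V hU hV hUV
    have hU' : Uᵀ * U = 1 := mul_eq_one_comm.1 hU
    have hV' : Vᵀ * V = 1 := mul_eq_one_comm.1 hV
    have f1 : U * P * Uᵀ = P := by
      refine psd_sq_unique (by simpa using hP.mul_mul_conjTranspose_same U) hP ?_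
      have g1 : Uᵀ * Mᵀ = Mᵀ * Vᵀ := by
        rw [← Matrix.transpose_mul, hUV, Matrix.transpose_mul]
      have g2 : Uᵀ * (Mᵀ * M) * U = Mᵀ * M := by
        calc _ = (Uᵀ * Mᵀ) * (M * U) := by simp only [Matrix.mul_assoc]
          _ = Mᵀ * (Vᵀ * V) * M := by rw [g1, hUV]; simp only [Matrix.mul_assoc]
          _ = _ := by rw [hV', Matrix.mul_one]
      calc _ = U * P * (Uᵀ * U) * P * Uᵀ := by simp only [Matrix.mul_assoc]
        _ = U * (P * P) * Uᵀ := by rw [hU', Matrix.mul_one]; simp only [Matrix.mul_assoc]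
        _ = U * (Uᵀ * (Mᵀ * M) * U) * Uᵀ := by rw [hPA, g2]
        _ = (U * Uᵀ) * (Mᵀ * M) * (U * Uᵀ) := by simp only [Matrix.mul_assoc]
        _ = P * P := by rw [hU, Matrix.one_mul, Matrix.mul_one, hPA]
    have f2 : U * P = P * U := by
      calc U * P = U * P * (Uᵀ * U) := by rw [hU', Matrix.mul_one]
        _ = (U * P * Uᵀ) * U := by simp only [Matrix.mul_assoc]
        _ = P * U := by rw [f1]
    have f3 : Q * U = U * Q := by
      calc Q * U = Q * U * (P * Q) := by rw [hPQ, Matrix.mul_one]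
        _ = Q * (U * P) * Q := by simp only [Matrix.mul_assoc]
        _ = (Q * P) * U * Q := by rw [f2]; simp only [Matrix.mul_assoc]
        _ = U * Q := by rw [hQP, Matrix.one_mul]
    symm
    calc M * Q * U * (M * Q)ᵀ = M * (Q * U) * (M * Q)ᵀ := by simp only [Matrix.mul_assoc]
      _ = (M * U) * Q * (M * Q)ᵀ := by rw [f3]; simp only [Matrix.mul_assoc]
      _ = V * ((M * Q) * (M * Q)ᵀ) := by rw [hUV]; simp only [Matrix.mul_assoc]
      _ = V := by rw [hTT, Matrix.mul_one]

/-- Proposition 3.2(ii): the passive (orthogonal symplectic) form of a symplectic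
representation is unique up to conjugation by an orthogonal symplectic matrix. -/
theorem passive_form_unique (n : ℕ) {G : Type} [Group G]
    (S : G → Matrix (Fin 2 × Fin n) (Fin 2 × Fin n) ℝ)
    (hS1 : S 1 = 1) (hSmul : ∀ g h : G, S (g * h) = S g * S h)
    (hSsymp : ∀ g, IsSymplectic (S g))
    (R R' : Matrix (Fin 2 × Fin n) (Fin 2 × Fin n) ℝ)
    (hR : IsSymplectic R) (hR' : IsSymplectic R')
    (hO : ∀ g, (R⁻¹ * S g * R) * (R⁻¹ * S g * R)ᵀ = 1)
    (hO' : ∀ g, (R'⁻¹ * S g * R') * (R'⁻¹ * S g * R')ᵀ = 1) :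
    ∃ T : Matrix (Fin 2 × Fin n) (Fin 2 × Fin n) ℝ,
      T * Tᵀ = 1 ∧ IsSymplectic T ∧
      ∀ g, R'⁻¹ * S g * R' = T * (R⁻¹ * S g * R) * Tᵀ := by
  obtain ⟨T, h1, h2, h3⟩ := polar_symplectic (hR'.inv.mul hR)
  refine ⟨T, h1, h2, fun g => h3 _ _ (hO g) (hO' g) ?_⟩
  have k1 : R * R⁻¹ = 1 := mul_eq_one_comm.1 hR.inv_mul
  have k2 : R' * R'⁻¹ = 1 := mul_eq_one_comm.1 hR'.inv_mul
  calc R'⁻¹ * R * (R⁻¹ * S g * R) = R'⁻¹ * (R * R⁻¹) * S g * R := by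
        simp only [Matrix.mul_assoc]
    _ = R'⁻¹ * S g * (R' * R'⁻¹) * R := by rw [k1, k2, Matrix.mul_one, Matrix.mul_one]
    _ = R'⁻¹ * S g * R' * (R'⁻¹ * R) := by simp only [Matrix.mul_assoc]
end
end
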